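/- Let X be a first countable compact Hausdorff space. If φ : C(X) → C(X) is a surjective function satisfying range(φ(f)·φ(g)) = range(f·g) for all f, g ∈ C(X), then there exist a homeomorphism ψ : X → X and a continuous function τ : X → {−1, 1} such that φ(f)(x) = τ(x)·f(ψ(x)) for all x ∈ X and f ∈ C(X). -/

import Mathlib

open Set in
/-- In a first countable compact Hausdorff space every point admits a peak function. -/
theorem exists_peak_function {X : Type*} [TopologicalSpace X] [CompactSpace X] [T2Space X]
    [FirstCountableTopology X] (x : X) :
    ∃ p : C(X, ℂ), (∀ z, ‖p z‖ ≤ 1) ∧ p x = 1 ∧ ∀ z, ‖p z‖ = 1 → z = x := by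
  obtain ⟨f, hf, -, -, hI⟩ := exists_continuous_one_zero_of_isCompact_of_isGδ
    (isCompact_singleton (x := x)) (IsGδ.singleton x) isClosed_empty (disjoint_empty _)
  have hn : ∀ z, ‖((f z : ℝ) : ℂ)‖ = f z := fun z => by
    rw [Complex.norm_real, Real.norm_of_nonneg (hI z).1]
  refine ⟨⟨fun z => (f z : ℂ), by fun_prop⟩, fun z => ?_, ?_, fun z hz => ?_⟩
  · exact (hn z).trans_le (hI z).2
  · have : x ∈ f ⁻¹' {1} := hf ▸ mem_singleton x
    have hx : f x = 1 := this
    simp [hx]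
  · have : z ∈ f ⁻¹' {1} := (hn z).symm.trans hz
    rw [← hf] at this
    exact this

/-- A function bounded by one, equal to one wherever `‖f‖ ≤ c`, which truncates `f` at
modulus `c`. -/
theorem exists_damping_function {X : Type*} [TopologicalSpace X] (f : C(X, ℂ)) {c : ℝ}
    (hc : 0 < c) :
    ∃ d : C(X, ℂ), (∀ z, ‖d z‖ ≤ 1) ∧ (∀ z, ‖f z‖ ≤ c → d z = 1) ∧
      ∀ z, ‖f z‖ * ‖d z‖ ≤ c := by
  have hpos : ∀ z, 0 < max ‖f z‖ c := fun z => lt_max_of_lt_right hc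
  have hcont : Continuous fun z => c / max ‖f z‖ c :=
    continuous_const.div (by fun_prop) fun z => (hpos z).ne'
  have hn : ∀ z, ‖((c / max ‖f z‖ c : ℝ) : ℂ)‖ = c / max ‖f z‖ c := fun z => by
    rw [Complex.norm_real, Real.norm_of_nonneg (div_nonneg hc.le (hpos z).le)]
  refine ⟨⟨fun z => ((c / max ‖f z‖ c : ℝ) : ℂ), by fun_prop⟩, fun z => ?_, fun z hz => ?_,
    fun z => ?_⟩
  · exact (hn z).trans_le ((div_le_one (hpos z)).2 (le_max_right _ _))
  · simp only [ContinuousMap.coe_mk, max_eq_right hz, div_self hc.ne', Complex.ofReal_one]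
  · simp only [ContinuousMap.coe_mk, hn]
    rw [mul_div_assoc', div_le_iff₀ (hpos z), mul_comm]
    exact mul_le_mul_of_nonneg_left (le_max_left _ _) hc.le

theorem norm_eq_one_of_mul_eq_one {a b : ℂ} (ha : ‖a‖ ≤ 1) (hb : ‖b‖ ≤ 1) (h : a * b = 1) :
    ‖a‖ = 1 := by
  have h1 : ‖a‖ * ‖b‖ = 1 := by rw [← norm_mul, h, norm_one]
  nlinarith [norm_nonneg a, norm_nonneg b]

theorem norm_apply_le_of_range_eq {X : Type*} [TopologicalSpace X] {f g : C(X, ℂ)}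
    (h : Set.range f = Set.range g) {c : ℝ} (hg : ∀ z, ‖g z‖ ≤ c) (z : X) : ‖f z‖ ≤ c := by
  obtain ⟨w, hw⟩ : f z ∈ Set.range g := h ▸ Set.mem_range_self z
  exact hw ▸ hg w

/-- A function equal to one at `x` is sent to a function equal to one at `y`, once this can be
tested against a function `g` with `g x = 1` corresponding to a peak function at `y`. -/
theorem apply_eq_one_of_range_mul_eq {X : Type*} [TopologicalSpace X] {p P g G : C(X, ℂ)}
    {x y : X} (hmul : Set.range ⇑(P * G) = Set.range ⇑(p * g)) (hP : ∀ z, ‖P z‖ ≤ 1)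
    (hG : ∀ z, ‖G z‖ ≤ 1) (hGy : G y = 1) (hpeak : ∀ z, ‖G z‖ = 1 → z = y)
    (hp : p x = 1) (hg : g x = 1) : P y = 1 := by
  obtain ⟨w, hw⟩ : (1 : ℂ) ∈ Set.range ⇑(P * G) := hmul ▸ ⟨x, by simp [hp, hg]⟩
  rw [ContinuousMap.mul_apply] at hw
  obtain rfl := hpeak w (norm_eq_one_of_mul_eq_one (hG w) (hP w) (by rw [mul_comm, hw]))
  rwa [hGy, mul_one] at hw

theorem exists_apply_eq_of_range_mul_eq {X : Type*} [TopologicalSpace X] [CompactSpace X]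
    [T2Space X] [FirstCountableTopology X] {φ : C(X, ℂ) → C(X, ℂ)}
    (hsurj : Function.Surjective φ)
    (hrange : ∀ f g : C(X, ℂ), Set.range ⇑(φ f * φ g) = Set.range ⇑(f * g))
    (hφ : ∀ f, Set.range (φ f) = Set.range f) (y : X) : ∃ x, ∀ f, φ f y = f x := by
  obtain ⟨q, hq, hqy, hqpeak⟩ := exists_peak_function y
  obtain ⟨g, hg⟩ := hsurj q
  obtain ⟨x, hx⟩ : (1 : ℂ) ∈ Set.range g := hφ g ▸ ⟨y, by rw [hg, hqy]⟩
  obtain ⟨p, hp, hpx, hppeak⟩ := exists_peak_function x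
  have forward : ∀ h : C(X, ℂ), (∀ z, ‖h z‖ ≤ 1) → h x = 1 → φ h y = 1 := fun h hh hhx =>
    apply_eq_one_of_range_mul_eq (hg ▸ hrange h g) (norm_apply_le_of_range_eq (hφ h) hh)
      hq hqy hqpeak hhx hx
  have backward : ∀ h : C(X, ℂ), (∀ z, ‖φ h z‖ ≤ 1) → φ h y = 1 → h x = 1 := fun h hh hhy =>
    apply_eq_one_of_range_mul_eq (hrange h p).symm
      (norm_apply_le_of_range_eq (hφ h).symm hh) hp hpx hppeak hhy (forward p hp hpx)
  refine ⟨x, fun f => ?_⟩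
  have hle : ‖f x‖ ≤ ‖φ f y‖ := le_of_forall_gt_imp_ge_of_dense fun c hc => by
    obtain ⟨d, hd, hd1, hfd⟩ := exists_damping_function (φ f) ((norm_nonneg _).trans_lt hc)
    obtain ⟨h, rfl⟩ := hsurj d
    have := norm_apply_le_of_range_eq (hrange f h).symm
      (fun z => by simpa using hfd z) x
    simpa [backward h hd (hd1 y hc.le)] using this
  have hge : ‖φ f y‖ ≤ ‖f x‖ := le_of_forall_gt_imp_ge_of_dense fun c hc => by
    obtain ⟨d, hd, hd1, hfd⟩ := exists_damping_function f ((norm_nonneg _).trans_lt hc)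
    have := norm_apply_le_of_range_eq (hrange f d) (fun z => by simpa using hfd z) y
    simpa [forward d hd (hd1 x hc.le)] using this
  rcases eq_or_ne (f x) 0 with h0 | h0
  · rw [h0, norm_zero] at hge
    rw [h0, norm_le_zero_iff.1 hge]
  have hpos : 0 < ‖f x‖ := norm_pos_iff.2 h0
  obtain ⟨d, hd, hd1, hfd⟩ := exists_damping_function f hpos
  have hdp : φ (d * p) y = 1 := by
    refine forward _ (fun z => ?_) (by simp [hd1 x le_rfl, hpx])
    rw [ContinuousMap.mul_apply, norm_mul]
    exact mul_le_one₀ (hd z) (norm_nonneg _) (hp z)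
  obtain ⟨w, hw⟩ : φ f y ∈ Set.range ⇑(f * (d * p)) := hrange f (d * p) ▸ ⟨y, by simp [hdp]⟩
  have hnorm : ‖f w‖ * ‖d w‖ * ‖p w‖ = ‖f x‖ := by
    rw [← hle.antisymm hge |>.symm, ← hw]
    simp [mul_assoc]
  have hpw : ‖p w‖ = 1 := by
    refine (hp w).antisymm ?_
    have := mul_le_mul_of_nonneg_right (hfd w) (norm_nonneg (p w))
    rw [hnorm] at this
    exact (le_mul_iff_one_le_right hpos).1 this
  obtain rfl := hppeak w hpw
  rw [← hw]
  simp [hd1 w le_rfl, hpx]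

theorem exists_homeomorph_of_range_mul_eq {X : Type*} [TopologicalSpace X] [CompactSpace X]
    [T2Space X] [FirstCountableTopology X] {φ : C(X, ℂ) → C(X, ℂ)}
    (hsurj : Function.Surjective φ)
    (hrange : ∀ f g : C(X, ℂ), Set.range ⇑(φ f * φ g) = Set.range ⇑(f * g))
    (hφ : ∀ f, Set.range (φ f) = Set.range f) :
    ∃ ψ : X ≃ₜ X, ∀ f x, φ f x = f (ψ x) := by
  choose ψ hψ using exists_apply_eq_of_range_mul_eq hsurj hrange hφ
  have hcont : Continuous ψ := by
    refine continuous_iff_continuousAt.2 fun y U hU => ?_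
    obtain ⟨V, hVU, hVo, hyV⟩ := mem_nhds_iff.1 hU
    obtain ⟨f, hf0, hf1, -⟩ := exists_continuous_zero_one_of_isClosed
      hVo.isClosed_compl (isClosed_singleton (x := ψ y))
      (Set.disjoint_singleton_right.2 fun h => h hyV)
    let F : C(X, ℂ) := ⟨fun z => (f z : ℂ), by fun_prop⟩
    have hy : φ F y ≠ 0 := by
      rw [hψ y F]
      simp [F, hf1 (Set.mem_singleton _)]
    rw [Filter.mem_map]
    filter_upwards [(φ F).continuous.continuousAt.eventually_ne hy] with z hz
    refine hVU (by_contra fun h => hz ?_)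
    rw [hψ z F]
    simp [F, hf0 h]
  have hinj : Function.Injective ψ := fun a b hab => by
    obtain ⟨q, -, hq1, hq⟩ := exists_peak_function b
    obtain ⟨g, rfl⟩ := hsurj q
    refine hq a ?_
    rw [hψ a g, hab, ← hψ b g, hq1, norm_one]
  have hsur : Function.Surjective ψ := fun x => by
    obtain ⟨p, -, hp1, hp⟩ := exists_peak_function x
    obtain ⟨y, hy⟩ : (1 : ℂ) ∈ Set.range (φ p) := hφ p ▸ ⟨x, hp1⟩
    exact ⟨y, hp _ (by rw [← hψ y p, hy, norm_one])⟩
  exact ⟨Continuous.homeoOfEquivCompactToT2 (f := Equiv.ofBijective ψ ⟨hinj, hsur⟩) hcont,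
    fun f x => hψ x f⟩

theorem stmt14 {X : Type*} [TopologicalSpace X] [CompactSpace X] [T2Space X]
    [FirstCountableTopology X]
    (φ : C(X, ℂ) → C(X, ℂ)) (hsurj : Function.Surjective φ)
    (hrange : ∀ f g : C(X, ℂ),
      Set.range ⇑(φ f * φ g) = Set.range ⇑(f * g)) :
    ∃ (ψ : X ≃ₜ X) (τ : C(X, ℝ)),
      (∀ x, τ x = 1 ∨ τ x = -1) ∧
      ∀ (f : C(X, ℂ)) (x : X), φ f x = (τ x : ℂ) * f (ψ x) := by
  have hsq : φ 1 * φ 1 = 1 := by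
    ext x
    obtain ⟨w, hw⟩ : (φ 1 * φ 1) x ∈ Set.range ⇑(1 * 1 : C(X, ℂ)) :=
      hrange 1 1 ▸ Set.mem_range_self x
    rw [← hw]
    simp
  have hcancel : ∀ f, φ 1 * (φ 1 * f) = f := fun f => by rw [← mul_assoc, hsq, one_mul]
  obtain ⟨ψ, hψ⟩ := exists_homeomorph_of_range_mul_eq (φ := fun f => φ 1 * φ f)
    (fun h => by
      obtain ⟨f, hf⟩ := hsurj (φ 1 * h)
      exact ⟨f, by simp only [hf, hcancel]⟩)
    (fun f g => by
      rw [mul_mul_mul_comm, hsq, one_mul, hrange])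
    (fun f => by rw [hrange, one_mul])
  have hsign : ∀ x, φ 1 x = 1 ∨ φ 1 x = -1 := fun x =>
    mul_self_eq_one_iff.1 (by simpa using DFunLike.congr_fun hsq x)
  refine ⟨ψ, ⟨fun x => (φ 1 x).re, by fun_prop⟩, fun x => ?_, fun f x => ?_⟩
  · rcases hsign x with h | h <;> simp [h]
  · have hre : (((φ 1 x).re : ℝ) : ℂ) = φ 1 x := by
      rcases hsign x with h | h <;> simp [h]
    simp only [ContinuousMap.coe_mk, hre, ← hψ f x]
    exact (DFunLike.congr_fun (hcancel (φ f)) x).symm
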